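/- Let k ≥ 2 and 2 ≤ j ≤ k, and let 0 < p < p̃. Then there exists a constant λ ≥ 1, independent of L, such that for every L ≥ 0 and every f : {0,1}^{T_L} → ℝ on the ball T_L of radius L centered at r in the (k+1)-regular tree, Var_μ(f) ≤ λ · ∑_{x ∈ T_L} μ( c_x · Var_x(f) ), where c_x(η) = 1 if x is a leaf (at distance L from r) and otherwise c_x(η) = 1 if and only if at least j neighbors y of x in T_L satisfy η_y = 0. (Equivalently: the spectral gap of the unoriented FA-jf model on finite regular trees with unconstrained leaves is bounded away from 0 uniformly in the depth, for any p below the critical density p̃.) -/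

import Mathlib

open scoped Classical

noncomputable section

/-- The bootstrap recursion map `g_p(x) = p·∑_{i=k-j+1}^{k} C(k,i) xⁱ (1-x)^{k-i}`. -/
def g (k j : ℕ) (p x : ℝ) : ℝ :=
  p * ∑ i ∈ Finset.Icc (k - j + 1) k, (Nat.choose k i : ℝ) * x ^ i * (1 - x) ^ (k - i)

/-- The critical threshold `p̃`: the supremum of the densities `p ∈ [0,1]` for which
`x = 0` is the unique fixed point of `g_p` in `[0,1]`. -/
def ptilde (k j : ℕ) : ℝ :=
  sSup {p : ℝ | p ∈ Set.Icc (0 : ℝ) 1 ∧ ∀ x ∈ Set.Icc (0 : ℝ) 1, g k j p x = x → x = 0}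

section Bernoulli

variable {V : Type*} [Fintype V] [DecidableEq V]

/-- Bernoulli(p) product weight of a configuration (`true` = occupied, with probability `p`). -/
def wt (p : ℝ) (η : V → Bool) : ℝ := ∏ x : V, if η x then p else 1 - p

/-- Expectation under the Bernoulli(p) product measure μ. -/
def mean (p : ℝ) (f : (V → Bool) → ℝ) : ℝ := ∑ η : V → Bool, wt p η * f η

/-- Probability of an event under the Bernoulli(p) product measure μ. -/
def probEv (p : ℝ) (E : (V → Bool) → Prop) : ℝ := mean p (fun η => if E η then 1 else 0)

/-- Conditional expectation `μ_A(f)` of `f` given the coordinates outside `A`. -/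
def cexp (p : ℝ) (A : Finset V) (f : (V → Bool) → ℝ) (η : V → Bool) : ℝ :=
  ∑ ζ : V → Bool,
    (∏ x : V, if x ∈ A then (if ζ x then p else 1 - p) else (if ζ x = η x then 1 else 0)) * f ζ

/-- Conditional variance `Var_A(f)` on the coordinates of `A` given the remaining coordinates. -/
def cvar (p : ℝ) (A : Finset V) (f : (V → Bool) → ℝ) (η : V → Bool) : ℝ :=
  cexp p A (fun ζ => f ζ ^ 2) η - (cexp p A f η) ^ 2

/-- Variance `Var_μ(f)` under the Bernoulli(p) product measure. -/
def varTot (p : ℝ) (f : (V → Bool) → ℝ) : ℝ := mean p (fun η => f η ^ 2) - (mean p f) ^ 2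

end Bernoulli

/-- Vertices of the ball `T_L` of radius `L` centered at `r` in the `(k+1)`-regular tree:
the root (`none`) together with the words `v₁⋯v_{m+1}`, `m + 1 ≤ L`, where `v₁ ∈ Fin (k+1)`
and the subsequent letters lie in `Fin k`. -/
abbrev BV (k L : ℕ) := Option (Σ m : Fin L, Fin (k + 1) × (Fin m.val → Fin k))

/-- Depth (distance from the root `r`). -/
def bdepth {k L : ℕ} : BV k L → ℕ
  | none => 0
  | some ⟨m, _, _⟩ => m.val + 1

/-- `y` is a one-letter extension of `x`. -/
def oneStep {k L : ℕ} : BV k L → BV k L → Prop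
  | none, some ⟨m, _, _⟩ => m.val = 0
  | some ⟨m, a, w⟩, some ⟨m', b, w'⟩ =>
      a = b ∧ ∃ h : m'.val = m.val + 1, ∀ i : Fin m.val, w' (Fin.cast h.symm i.castSucc) = w i
  | _, _ => False

/-- Adjacency in the ball `T_L`: one of the two words is a one-letter extension of the other. -/
def adj {k L : ℕ} (x y : BV k L) : Prop := oneStep x y ∨ oneStep y x

/-- The unoriented FA-jf constraint with unconstrained leaves: `c_x(η) = 1` iff `x` is a leaf
(at distance `L` from the root) or at least `j` neighbors of `x` in `T_L` are empty. -/
def cU {k L : ℕ} (j : ℕ) (x : BV k L) (η : BV k L → Bool) : ℝ :=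
  if bdepth x = L then 1
  else if j ≤ (Finset.univ.filter fun y : BV k L => adj x y ∧ η y = false).card then 1 else 0
section Averaging

variable {V : Type*} [Fintype V] [DecidableEq V]

/-- Transition kernel of the resampling of the coordinates in `A`. -/
def resampleKernel (p : ℝ) (A : Finset V) (η ζ : V → Bool) : ℝ :=
  ∏ x : V, if x ∈ A then (if ζ x then p else 1 - p) else (if ζ x = η x then 1 else 0)

lemma cexp_eq_sum (p : ℝ) (A : Finset V) (f : (V → Bool) → ℝ) (η : V → Bool) :
    cexp p A f η = ∑ ζ, resampleKernel p A η ζ * f ζ := rfl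

lemma resampleKernel_nonneg {p : ℝ} (h0 : 0 ≤ p) (h1 : p ≤ 1) (A : Finset V) (η ζ : V → Bool) :
    0 ≤ resampleKernel p A η ζ := by
  refine Finset.prod_nonneg fun x _ => ?_
  split_ifs <;> linarith

lemma eq_of_resampleKernel_ne_zero {p : ℝ} {A : Finset V} {η ζ : V → Bool}
    (h : resampleKernel p A η ζ ≠ 0) {x : V} (hx : x ∉ A) : ζ x = η x := by
  by_contra hne
  exact h (Finset.prod_eq_zero (Finset.mem_univ x) (by simp [hx, hne]))

lemma sum_prod_apply (F : V → Bool → ℝ) :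
    ∑ ζ : V → Bool, ∏ x, F x (ζ x) = ∏ x, ∑ b, F x b := by
  rw [Finset.prod_univ_sum, Fintype.piFinset_univ]

lemma sum_resampleKernel (p : ℝ) (A : Finset V) (η : V → Bool) :
    ∑ ζ, resampleKernel p A η ζ = 1 := by
  unfold resampleKernel
  rw [sum_prod_apply fun x b =>
    if x ∈ A then (if b then p else 1 - p) else (if b = η x then 1 else 0)]
  refine Finset.prod_eq_one fun x _ => ?_
  by_cases hx : x ∈ A <;> cases h : η x <;> simp [hx]

lemma cexp_cexp (p : ℝ) (A B : Finset V) (f : (V → Bool) → ℝ) :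
    cexp p A (cexp p B f) = cexp p (A ∪ B) f := by
  funext η
  simp only [cexp_eq_sum, Finset.mul_sum]
  rw [Finset.sum_comm]
  refine Finset.sum_congr rfl fun ξ _ => ?_
  simp only [← mul_assoc, ← Finset.sum_mul]
  congr 1
  simp only [resampleKernel, ← Finset.prod_mul_distrib]
  rw [sum_prod_apply fun x b =>
    (if x ∈ A then (if b then p else 1 - p) else (if b = η x then 1 else 0)) *
      (if x ∈ B then (if ξ x then p else 1 - p) else (if ξ x = b then 1 else 0))]
  refine Finset.prod_congr rfl fun x _ => ?_
  by_cases hA : x ∈ A <;> by_cases hB : x ∈ B <;> cases h : η x <;> cases h' : ξ x <;>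
    simp [hA, hB] <;> ring

lemma mean_eq_cexp (p : ℝ) (f : (V → Bool) → ℝ) (η : V → Bool) :
    mean p f = cexp p Finset.univ f η := by
  simp [mean, cexp, wt]

lemma cexp_empty (p : ℝ) (f : (V → Bool) → ℝ) : cexp p ∅ f = f := by
  funext η
  rw [cexp_eq_sum, Finset.sum_eq_single η]
  · simp [resampleKernel]
  · intro ζ _ hne
    by_contra h
    exact hne (funext fun x => eq_of_resampleKernel_ne_zero (left_ne_zero_of_mul h) (by simp))
  · simp

lemma mean_cexp (p : ℝ) (A : Finset V) (f : (V → Bool) → ℝ) :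
    mean p (cexp p A f) = mean p f := by
  rw [mean_eq_cexp p _ (fun _ => true), mean_eq_cexp p f (fun _ => true), cexp_cexp,
    Finset.union_eq_left.2 (Finset.subset_univ A)]

lemma cexp_mul_left (p : ℝ) {A : Finset V} {G : (V → Bool) → ℝ} (hG : DependsOn G (↑A)ᶜ)
    (f : (V → Bool) → ℝ) : cexp p A (fun ζ => G ζ * f ζ) = fun η => G η * cexp p A f η := by
  funext η
  simp only [cexp_eq_sum, Finset.mul_sum]
  refine Finset.sum_congr rfl fun ζ _ => ?_
  by_cases h : resampleKernel p A η ζ = 0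
  · simp [h]
  · rw [hG (x := ζ) (y := η) fun x hx => eq_of_resampleKernel_ne_zero h (by simpa using hx)]
    ring

lemma cexp_add (p : ℝ) (A : Finset V) (f h : (V → Bool) → ℝ) :
    cexp p A (f + h) = cexp p A f + cexp p A h := by
  funext η
  simp [cexp_eq_sum, mul_add, Finset.sum_add_distrib]

lemma cexp_sub (p : ℝ) (A : Finset V) (f h : (V → Bool) → ℝ) :
    cexp p A (f - h) = cexp p A f - cexp p A h := by
  funext η
  simp [cexp_eq_sum, mul_sub, Finset.sum_sub_distrib]

lemma mean_add (p : ℝ) (f h : (V → Bool) → ℝ) : mean p (f + h) = mean p f + mean p h := by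
  simp [mean, mul_add, Finset.sum_add_distrib]

lemma mean_sub (p : ℝ) (f h : (V → Bool) → ℝ) : mean p (f - h) = mean p f - mean p h := by
  simp [mean, mul_sub, Finset.sum_sub_distrib]

lemma mean_const_mul (p c : ℝ) (f : (V → Bool) → ℝ) :
    mean p (fun η => c * f η) = c * mean p f := by
  simp only [mean, Finset.mul_sum]
  exact Finset.sum_congr rfl fun _ _ => by ring

lemma cexp_const (p : ℝ) (A : Finset V) (c : ℝ) (η : V → Bool) :
    cexp p A (fun _ => c) η = c := by
  rw [cexp_eq_sum, ← Finset.sum_mul, sum_resampleKernel, one_mul]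

lemma mean_const (p c : ℝ) : mean p (fun _ : V → Bool => c) = c := by
  rw [mean_eq_cexp p _ (fun _ => true), cexp_const]

lemma cexp_mono {p : ℝ} (h0 : 0 ≤ p) (h1 : p ≤ 1) (A : Finset V) {f h : (V → Bool) → ℝ}
    (hfh : f ≤ h) : cexp p A f ≤ cexp p A h := fun η =>
  Finset.sum_le_sum fun ζ _ =>
    mul_le_mul_of_nonneg_left (hfh ζ) (resampleKernel_nonneg h0 h1 A η ζ)

lemma mean_mono {p : ℝ} (h0 : 0 ≤ p) (h1 : p ≤ 1) {f h : (V → Bool) → ℝ} (hfh : f ≤ h) :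
    mean p f ≤ mean p h := by
  rw [mean_eq_cexp p f (fun _ => true), mean_eq_cexp p h (fun _ => true)]
  exact cexp_mono h0 h1 _ hfh _

lemma mean_nonneg {p : ℝ} (h0 : 0 ≤ p) (h1 : p ≤ 1) {f : (V → Bool) → ℝ} (hf : 0 ≤ f) :
    0 ≤ mean p f := by
  have := mean_mono h0 h1 hf
  rwa [show (0 : (V → Bool) → ℝ) = fun _ => 0 from rfl, mean_const] at this

/-- Cauchy–Schwarz inequality for the conditional expectation. -/
lemma cexp_mul_sq_le {p : ℝ} (h0 : 0 ≤ p) (h1 : p ≤ 1) (A : Finset V) (u f : (V → Bool) → ℝ)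
    (η : V → Bool) :
    cexp p A (fun ζ => u ζ * f ζ) η ^ 2 ≤
      cexp p A (fun ζ => u ζ ^ 2) η * cexp p A (fun ζ => f ζ ^ 2) η := by
  refine Finset.sum_sq_le_sum_mul_sum_of_sq_le_mul _ (fun ζ _ => ?_) (fun ζ _ => ?_)
    (fun ζ _ => ?_)
  · exact mul_nonneg (resampleKernel_nonneg h0 h1 A η ζ) (sq_nonneg _)
  · exact mul_nonneg (resampleKernel_nonneg h0 h1 A η ζ) (sq_nonneg _)
  · exact le_of_eq (by ring)

lemma cexp_sq_le {p : ℝ} (h0 : 0 ≤ p) (h1 : p ≤ 1) (A : Finset V) (f : (V → Bool) → ℝ)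
    (η : V → Bool) : cexp p A f η ^ 2 ≤ cexp p A (fun ζ => f ζ ^ 2) η := by
  have := cexp_mul_sq_le h0 h1 A (fun _ => 1) f η
  simpa [cexp_const] using this

lemma dependsOn_cexp (p : ℝ) (A : Finset V) (f : (V → Bool) → ℝ) :
    DependsOn (cexp p A f) (↑A)ᶜ := by
  intro η ζ h
  simp only [cexp]
  refine Finset.sum_congr rfl fun ξ _ => ?_
  congr 1
  refine Finset.prod_congr rfl fun x _ => ?_
  by_cases hx : x ∈ A
  · simp [hx]
  · rw [h x (by simpa using hx)]

lemma cexp_of_dependsOn (p : ℝ) {A : Finset V} {G : (V → Bool) → ℝ} (hG : DependsOn G (↑A)ᶜ) :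
    cexp p A G = G := by
  have := cexp_mul_left p hG (fun _ => 1)
  simpa [cexp_const] using this

/-- Second moment under the Bernoulli measure. -/
def normSq (p : ℝ) (f : (V → Bool) → ℝ) : ℝ := mean p (fun η => f η ^ 2)

lemma normSq_nonneg {p : ℝ} (h0 : 0 ≤ p) (h1 : p ≤ 1) (f : (V → Bool) → ℝ) :
    0 ≤ normSq p f := mean_nonneg h0 h1 fun _ => sq_nonneg _

lemma normSq_cexp_le {p : ℝ} (h0 : 0 ≤ p) (h1 : p ≤ 1) (A : Finset V) (f : (V → Bool) → ℝ) :
    normSq p (cexp p A f) ≤ normSq p f := by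
  rw [normSq, normSq, ← mean_cexp p A (fun η => f η ^ 2)]
  exact mean_mono h0 h1 fun η => cexp_sq_le h0 h1 A f η

lemma normSq_add_le {p : ℝ} (h0 : 0 ≤ p) (h1 : p ≤ 1) (f h : (V → Bool) → ℝ) :
    normSq p (f + h) ≤ 2 * normSq p f + 2 * normSq p h := by
  simp only [normSq]
  rw [← mean_const_mul, ← mean_const_mul, ← mean_add]
  refine mean_mono h0 h1 fun η => ?_
  simp only [Pi.add_apply]
  nlinarith [sq_nonneg (f η - h η)]

lemma normSq_sub_cexp (p : ℝ) (A : Finset V) (f : (V → Bool) → ℝ) :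
    normSq p (f - cexp p A f) = normSq p f - normSq p (cexp p A f) := by
  have hpull : mean p (fun η => cexp p A f η * f η) = normSq p (cexp p A f) := by
    rw [← mean_cexp p A, cexp_mul_left p (dependsOn_cexp p A f)]
    simp [normSq, sq]
  have : (fun η => (f - cexp p A f) η ^ 2) =
      ((fun η => f η ^ 2) - fun η => 2 * (cexp p A f η * f η)) + fun η => cexp p A f η ^ 2 := by
    funext η
    simp only [Pi.sub_apply, Pi.add_apply]
    ring
  rw [normSq, this, mean_add, mean_sub, mean_const_mul, hpull]
  simp only [normSq]
  ring

lemma normSq_sub_cexp_le {p : ℝ} (h0 : 0 ≤ p) (h1 : p ≤ 1) (A : Finset V)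
    (f : (V → Bool) → ℝ) : normSq p (f - cexp p A f) ≤ normSq p f := by
  rw [normSq_sub_cexp]
  linarith [normSq_nonneg h0 h1 (cexp p A f)]

lemma cexp_comm (p : ℝ) (A B : Finset V) (f : (V → Bool) → ℝ) :
    cexp p A (cexp p B f) = cexp p B (cexp p A f) := by
  rw [cexp_cexp, cexp_cexp, Finset.union_comm]

lemma mean_mul_cvar (p : ℝ) {A : Finset V} {G : (V → Bool) → ℝ} (hG : DependsOn G (↑A)ᶜ)
    (f : (V → Bool) → ℝ) :
    mean p (fun η => G η * cvar p A f η) = mean p (fun η => G η * (f - cexp p A f) η ^ 2) := by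
  have h1 : mean p (fun η => G η * cexp p A (fun ζ => f ζ ^ 2) η) =
      mean p (fun η => G η * f η ^ 2) := by
    rw [← cexp_mul_left p hG, mean_cexp]
  have hGE : DependsOn (fun η => G η * cexp p A f η) (↑A)ᶜ := fun η ζ h => by
    simp only [hG h, dependsOn_cexp p A f h]
  have h2 : mean p (fun η => G η * cexp p A f η * f η) =
      mean p (fun η => G η * cexp p A f η ^ 2) := by
    rw [← mean_cexp p A, cexp_mul_left p hGE]
    simp [sq, mul_assoc]
  have e1 : (fun η => G η * cvar p A f η) =
      (fun η => G η * cexp p A (fun ζ => f ζ ^ 2) η) - fun η => G η * cexp p A f η ^ 2 := by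
    funext η
    simp only [cvar, Pi.sub_apply]
    ring
  have e2 : (fun η => G η * (f - cexp p A f) η ^ 2) =
      ((fun η => G η * f η ^ 2) - fun η => 2 * (G η * cexp p A f η * f η)) +
        fun η => G η * cexp p A f η ^ 2 := by
    funext η
    simp only [Pi.sub_apply, Pi.add_apply]
    ring
  rw [e1, e2, mean_add, mean_sub, mean_sub, mean_const_mul, h1, h2]
  ring

lemma cvar_nonneg {p : ℝ} (h0 : 0 ≤ p) (h1 : p ≤ 1) (A : Finset V) (f : (V → Bool) → ℝ)
    (η : V → Bool) : 0 ≤ cvar p A f η :=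
  sub_nonneg.2 (cexp_sq_le h0 h1 A f η)

lemma mean_mul_of_disjoint (p : ℝ) {F G : (V → Bool) → ℝ} {A B : Finset V}
    (hF : DependsOn F ↑A) (hG : DependsOn G ↑B) (hAB : Disjoint A B) :
    mean p (fun η => F η * G η) = mean p F * mean p G := by
  have hG' : DependsOn G (↑A)ᶜ :=
    hG.mono fun x hx hxA => Finset.disjoint_left.1 hAB hxA hx
  have hFA : cexp p A F = fun _ => mean p F := by
    funext η
    have hF' : cexp p Aᶜ F = F := cexp_of_dependsOn p (by simpa using hF)
    rw [mean_eq_cexp p F η, ← Finset.union_compl A, ← cexp_cexp, hF']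
  rw [← mean_const_mul, ← mean_cexp p A]
  have : (fun η => F η * G η) = fun η => G η * F η := funext fun η => mul_comm _ _
  rw [this, cexp_mul_left p hG', hFA]
  simp only [mul_comm]

lemma mean_prod_of_pairwiseDisjoint {ι : Type*} (p : ℝ) (S : Finset ι)
    (F : ι → (V → Bool) → ℝ) (A : ι → Finset V) (hF : ∀ i ∈ S, DependsOn (F i) ↑(A i))
    (hA : (S : Set ι).PairwiseDisjoint A) :
    mean p (fun η => ∏ i ∈ S, F i η) = ∏ i ∈ S, mean p (F i) := by
  classical
  induction S using Finset.induction_on with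
  | empty => simp [mean_const]
  | insert a S ha ih =>
    simp only [Finset.prod_insert ha]
    rw [mean_mul_of_disjoint p (B := S.biUnion A) (hF a (Finset.mem_insert_self _ _)),
      ih (fun i hi => hF i (Finset.mem_insert_of_mem hi))
        (hA.subset (by simp))]
    · intro η ζ h
      refine Finset.prod_congr rfl fun i hi => hF i (Finset.mem_insert_of_mem hi) fun x hx => ?_
      exact h x (by simpa using ⟨i, hi, hx⟩)
    · rw [Finset.disjoint_biUnion_right]
      intro i hi
      exact hA (by simp) (by simp [hi]) (by rintro rfl; exact ha hi)

end Averaging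

section Poincare

variable {V : Type*} [Fintype V] [DecidableEq V]

/-- Martingale decomposition of the second moment along an injective ordering `e` of the sites. -/
lemma normSq_sub_normSq_cexp_eq_sum {p : ℝ} {e : V → ℕ} (he : Function.Injective e)
    (S : Finset V) (f : (V → Bool) → ℝ) :
    normSq p f - normSq p (cexp p S f) =
      ∑ y ∈ S, normSq p (cexp p (S.filter fun z => e y < e z) f -
        cexp p {y} (cexp p (S.filter fun z => e y < e z) f)) := by
  induction S using Finset.induction_on_min_value e with
  | empty => simp [cexp_empty]
  | insert a s ha hmin ih =>
    rw [Finset.sum_insert ha]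
    have hsa : (insert a s).filter (fun z => e a < e z) = s := by
      ext z
      simp only [Finset.mem_filter, Finset.mem_insert]
      constructor
      · rintro ⟨rfl | h, h'⟩
        · exact absurd h' (lt_irrefl _)
        · exact h
      · intro h
        refine ⟨Or.inr h, lt_of_le_of_ne (hmin z h) fun h' => ha ?_⟩
        rwa [he h']
    have hsy : ∀ y ∈ s, (insert a s).filter (fun z => e y < e z) =
        s.filter (fun z => e y < e z) := by
      intro y hy
      rw [Finset.filter_insert, if_neg (not_lt.2 (hmin y hy))]
    rw [hsa, Finset.sum_congr rfl (fun y hy => by rw [hsy y hy]), ← ih, normSq_sub_cexp,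
      cexp_cexp, ← Finset.insert_eq]
    ring

/-- Long-range constrained Poincaré inequality: if the constraint `c x` at `x` is determined by
sites `Δ x` which come later in the ordering `e`, and if it fails with small probability compared
to the multiplicity of the sets `Δ x`, then the variance is controlled by the constrained
Dirichlet form. -/
theorem varTot_le_of_constraint {p : ℝ} (h0 : 0 ≤ p) (h1 : p ≤ 1) {e : V → ℕ}
    (he : Function.Injective e) (Δ : V → Finset V) (hΔ : ∀ x, ∀ y ∈ Δ x, e x < e y)
    (c : V → (V → Bool) → ℝ) (hc : ∀ x η, c x η = 0 ∨ c x η = 1)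
    (hcΔ : ∀ x, DependsOn (c x) ↑(Δ x)) {δ : ℝ} {M : ℕ}
    (hδ : ∀ x, mean p (fun η => 1 - c x η) ≤ δ)
    (hM : ∀ y, (Finset.univ.filter fun x => y ∈ insert x (Δ x)).card ≤ M)
    (hδM : 4 * (δ * M) ≤ 1) (f : (V → Bool) → ℝ) :
    varTot p f ≤ 4 * ∑ x, mean p (fun η => c x η * cvar p {x} f η) := by
  rcases isEmpty_or_nonempty V with hV | ⟨⟨v⟩⟩
  · have : ∀ f : (V → Bool) → ℝ, mean p f = f (fun _ => true) := fun f => by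
      simp [mean, wt, Subsingleton.elim _ (fun _ : V => true)]
    simp [varTot, this]
  have hδ0 : 0 ≤ δ := by
    refine le_trans (mean_nonneg h0 h1 fun η => ?_) (hδ v)
    rcases hc v η with h | h <;> simp [h]
  set after : V → Finset V := fun x => Finset.univ.filter fun z => e x < e z with hafter
  set a : V → ℝ := fun x => normSq p (cexp p (after x) f - cexp p {x} (cexp p (after x) f))
    with ha
  have hvar : varTot p f = ∑ x, a x := by
    rw [← normSq_sub_normSq_cexp_eq_sum he Finset.univ f, varTot]
    congr 1
    have : cexp p Finset.univ f = fun _ => mean p f := funext fun η => (mean_eq_cexp p f η).symm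
    rw [normSq, this, mean_const]
  have hloc : ∀ x, a x ≤ 2 * mean p (fun η => c x η * cvar p {x} f η) +
      2 * (δ * ∑ y ∈ insert x (Δ x), a y) := by
    intro x
    set D := insert x (Δ x) with hD
    have hxΔ : x ∉ Δ x := fun h => lt_irrefl _ (hΔ x x h)
    have hcx : DependsOn (c x) (↑({x} : Finset V))ᶜ :=
      (hcΔ x).mono fun y hy => by
        simp only [Finset.coe_singleton, Set.mem_compl_iff, Set.mem_singleton_iff]
        rintro rfl
        exact hxΔ hy
    have hcx' : DependsOn (fun η => 1 - c x η) (↑({x} : Finset V))ᶜ := fun η ζ h => by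
      simp only [hcx h]
    set B := after x \ Δ x with hB
    have hΔB : Δ x ∪ B = after x := by
      ext z
      have := hΔ x z
      simp only [hB, hafter, Finset.mem_union, Finset.mem_sdiff, Finset.mem_filter,
        Finset.mem_univ, true_and]
      tauto
    have hcB : DependsOn (fun η => 1 - c x η) (↑B)ᶜ := fun η ζ h => by
      have : c x η = c x ζ := hcΔ x fun z hz => h z (by
        simp only [hB, Finset.coe_sdiff, Set.mem_compl_iff, Set.mem_sdiff]
        tauto)
      simp only [this]
    set q : ((V → Bool) → ℝ) → (V → Bool) → ℝ := fun h => h - cexp p {x} h with hq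
    have hqc : ∀ A h, q (cexp p A h) = cexp p A (q h) := fun A h => by
      simp only [hq, cexp_sub, cexp_comm p {x} A]
    set f₁ : (V → Bool) → ℝ := fun η => c x η * f η with hf₁
    set f₂ : (V → Bool) → ℝ := fun η => (1 - c x η) * f η with hf₂
    have hf : cexp p (after x) f = cexp p (after x) f₁ + cexp p (after x) f₂ := by
      rw [← cexp_add]
      congr 1
      funext η
      simp only [hf₁, hf₂, Pi.add_apply]
      ring
    have hax : a x ≤ 2 * normSq p (q (cexp p (after x) f₁)) +
        2 * normSq p (q (cexp p (after x) f₂)) := by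
      have : a x = normSq p (q (cexp p (after x) f₁) + q (cexp p (after x) f₂)) := by
        simp only [ha, hf, hq, cexp_add]
        congr 1
        abel
      rw [this]
      exact normSq_add_le h0 h1 _ _
    have hfirst : normSq p (q (cexp p (after x) f₁)) ≤
        mean p (fun η => c x η * cvar p {x} f η) := by
      rw [hqc]
      refine (normSq_cexp_le h0 h1 _ _).trans (le_of_eq ?_)
      rw [mean_mul_cvar p hcx, normSq]
      congr 1
      funext η
      simp only [hq, hf₁, cexp_mul_left p hcx, Pi.sub_apply]
      rcases hc x η with h | h <;> simp [h]
    have hsecond : normSq p (q (cexp p (after x) f₂)) ≤ δ * ∑ y ∈ D, a y := by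
      set G := cexp p B f with hG
      set H := G - cexp p D G with hH
      have h2 : q (cexp p (after x) f₂) = q (cexp p (Δ x) fun η => (1 - c x η) * H η) := by
        rw [← hΔB, ← cexp_cexp, hf₂, cexp_mul_left p hcB, hqc, hqc]
        congr 1
        funext η
        have hDD : cexp p {x} (cexp p D G) = cexp p D G := by
          rw [cexp_cexp]
          congr 1
          simp [hD]
        have hH' : cexp p {x} H = cexp p {x} G - cexp p D G := by rw [hH, cexp_sub, hDD]
        simp only [hq, Pi.sub_apply, cexp_mul_left p hcx', hH']
        simp only [hH, hG, Pi.sub_apply]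
        ring
      have h3 : normSq p (cexp p (Δ x) fun η => (1 - c x η) * H η) ≤ δ * normSq p H := by
        have hpt : ∀ η, cexp p (Δ x) (fun ζ => (1 - c x ζ) * H ζ) η ^ 2 ≤
            δ * cexp p (Δ x) (fun ζ => H ζ ^ 2) η := by
          intro η
          refine (cexp_mul_sq_le h0 h1 _ _ _ _).trans ?_
          refine mul_le_mul_of_nonneg_right ?_ ?_
          · have hsq : (fun ζ => (1 - c x ζ) ^ 2) = fun ζ => 1 - c x ζ := by
              funext ζ
              rcases hc x ζ with h | h <;> simp [h]
            have hcc : cexp p (Δ x)ᶜ (fun ζ => 1 - c x ζ) = fun ζ => 1 - c x ζ :=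
              cexp_of_dependsOn p fun η ζ h => by
                have : c x η = c x ζ := hcΔ x fun z hz => h z (by simpa using hz)
                simp only [this]
            rw [hsq]
            refine le_of_eq_of_le ?_ (hδ x)
            rw [mean_eq_cexp p _ η, ← Finset.union_compl (Δ x), ← cexp_cexp, hcc]
          · have := cexp_mono h0 h1 (Δ x) (f := fun _ => 0) (h := fun ζ => H ζ ^ 2)
              (fun _ => sq_nonneg _) η
            rwa [cexp_const] at this
        refine (mean_mono h0 h1 hpt).trans ?_
        rw [mean_const_mul, mean_cexp, normSq]
      have h4 : normSq p H ≤ ∑ y ∈ D, a y := by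
        rw [hH, normSq_sub_cexp, normSq_sub_normSq_cexp_eq_sum he]
        refine Finset.sum_le_sum fun y hy => ?_
        have hxy : e x ≤ e y := by
          rcases Finset.mem_insert.1 hy with rfl | h
          · exact le_rfl
          · exact (hΔ x y h).le
        have hsub : D.filter (fun z => e y < e z) ∪ B =
            (D.filter (fun z => e y < e z) ∪ B) ∪ after y := by
          refine (Finset.union_eq_left.2 fun z hz => ?_).symm
          have hz' : e y < e z := by simpa [hafter] using hz
          simp only [Finset.mem_union, Finset.mem_filter, hB, hD, Finset.mem_sdiff, hafter,
            Finset.mem_insert, Finset.mem_univ, true_and]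
          have := hxy.trans_lt hz'
          tauto
        have hcomp : cexp p (D.filter fun z => e y < e z) G =
            cexp p (D.filter (fun z => e y < e z) ∪ B) (cexp p (after y) f) := by
          rw [hG, cexp_cexp, cexp_cexp, ← hsub]
        rw [hcomp, cexp_comm p {y}, ← cexp_sub]
        exact normSq_cexp_le h0 h1 _ _
      rw [h2]
      exact (normSq_sub_cexp_le h0 h1 _ _).trans
        (h3.trans (mul_le_mul_of_nonneg_left h4 hδ0))
    linarith
  have ha0 : ∀ x, 0 ≤ a x := fun x => normSq_nonneg h0 h1 _
  have hcount : ∑ x, ∑ y ∈ insert x (Δ x), a y ≤ M * ∑ y, a y := by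
    have : ∑ x, ∑ y ∈ insert x (Δ x), a y =
        ∑ y, ∑ x ∈ Finset.univ.filter (fun x => y ∈ insert x (Δ x)), a y :=
      Finset.sum_comm' (by simp)
    rw [this, Finset.mul_sum]
    refine Finset.sum_le_sum fun y _ => ?_
    rw [Finset.sum_const, nsmul_eq_mul]
    exact mul_le_mul_of_nonneg_right (by exact_mod_cast hM y) (ha0 y)
  have hsum := Finset.sum_le_sum fun x (_ : x ∈ Finset.univ) => hloc x
  rw [Finset.sum_add_distrib, ← Finset.mul_sum, ← Finset.mul_sum, ← Finset.mul_sum] at hsum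
  have hA0 : 0 ≤ ∑ y, a y := Finset.sum_nonneg fun y _ => ha0 y
  have := mul_le_mul_of_nonneg_left hcount hδ0
  have := mul_le_mul_of_nonneg_right hδM hA0
  rw [hvar]
  nlinarith

end Poincare

section BootstrapMap

lemma g_eq_mul_g_one (k j : ℕ) (p x : ℝ) : g k j p x = p * g k j 1 x := by simp [g]

lemma g_nonneg (k j : ℕ) {p x : ℝ} (hp : 0 ≤ p) (hx0 : 0 ≤ x) (hx1 : x ≤ 1) :
    0 ≤ g k j p x :=
  mul_nonneg hp <| Finset.sum_nonneg fun _ _ =>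
    mul_nonneg (mul_nonneg (Nat.cast_nonneg _) (pow_nonneg hx0 _))
      (pow_nonneg (sub_nonneg.2 hx1) _)

lemma g_one_right {k j : ℕ} (hj : 1 ≤ j) (hjk : j ≤ k) (p : ℝ) : g k j p 1 = p := by
  unfold g
  rw [Finset.sum_eq_single k]
  · simp
  · intro i hi hik
    have : k - i ≠ 0 := by
      have := (Finset.mem_Icc.1 hi).2
      omega
    simp [this]
  · intro h
    exact absurd (Finset.mem_Icc.2 ⟨by omega, le_rfl⟩) h

lemma continuous_g (k j : ℕ) (p : ℝ) : Continuous (g k j p) := by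
  unfold g
  fun_prop

/-- Below a density at which `0` is the only fixed point, the bootstrap map is bounded by a
linear contraction. -/
lemma exists_contraction_of_lt_ptilde {k j : ℕ} {p : ℝ} (hj : 1 ≤ j) (hjk : j ≤ k) (hp0 : 0 < p)
    (hp : p < ptilde k j) :
    p < 1 ∧ ∃ ρ : ℝ, 0 ≤ ρ ∧ ρ < 1 ∧ ∀ x ∈ Set.Icc (0 : ℝ) 1, g k j p x ≤ ρ * x := by
  have hne : {p : ℝ | p ∈ Set.Icc (0 : ℝ) 1 ∧
      ∀ x ∈ Set.Icc (0 : ℝ) 1, g k j p x = x → x = 0}.Nonempty := by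
    by_contra h
    rw [ptilde, Set.not_nonempty_iff_eq_empty.1 h, Real.sSup_empty] at hp
    linarith
  obtain ⟨p', ⟨⟨hp'0, hp'1⟩, hfix⟩, hpp'⟩ := exists_lt_of_lt_csSup hne hp
  have hp'pos : 0 < p' := hp0.trans hpp'
  have hle : ∀ x ∈ Set.Icc (0 : ℝ) 1, g k j p' x ≤ x := by
    rintro x ⟨hx0, hx1⟩
    by_contra! hlt
    have hcont : ContinuousOn (fun y => y - g k j p' y) (Set.Icc x 1) :=
      (continuous_id.sub (continuous_g k j p')).continuousOn
    have hmem : (0 : ℝ) ∈ Set.Icc (x - g k j p' x) (1 - g k j p' 1) := by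
      rw [g_one_right hj hjk]
      constructor <;> linarith
    obtain ⟨y, ⟨hy0, hy1⟩, hy⟩ := intermediate_value_Icc hx1 hcont hmem
    have hyz := hfix y ⟨hx0.trans hy0, hy1⟩ (by simp only at hy; linarith)
    have hxz : x = 0 := le_antisymm (hyz ▸ hy0) hx0
    subst hyz
    rw [hxz] at hlt
    simp only [zero_sub, neg_eq_zero] at hy
    linarith
  refine ⟨hpp'.trans_le hp'1, p / p', by positivity, (div_lt_one hp'pos).2 hpp', fun x hx => ?_⟩
  have := mul_le_mul_of_nonneg_left (hle x hx) (div_nonneg hp0.le hp'0)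
  rw [g_eq_mul_g_one k j p', ← mul_assoc, div_mul_cancel₀ _ hp'pos.ne', ← g_eq_mul_g_one] at this
  exact this

end BootstrapMap

section SingleSite

variable {V : Type*} [Fintype V] [DecidableEq V]

lemma resampleKernel_update (p : ℝ) (x : V) (η : V → Bool) (b : Bool) :
    resampleKernel p {x} η (Function.update η x b) = if b then p else 1 - p := by
  rw [resampleKernel, Finset.prod_eq_single x]
  · simp
  · intro y _ hy
    simp [hy]
  · simp

lemma cexp_singleton (p : ℝ) (x : V) (f : (V → Bool) → ℝ) (η : V → Bool) :
    cexp p {x} f η =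
      p * f (Function.update η x true) + (1 - p) * f (Function.update η x false) := by
  have hne : Function.update η x true ≠ Function.update η x false := fun h => by
    simpa using congrFun h x
  rw [cexp_eq_sum, ← Finset.sum_subset (Finset.subset_univ
    {Function.update η x true, Function.update η x false}), Finset.sum_pair hne,
    resampleKernel_update, resampleKernel_update]
  · simp
  · intro ζ _ hζ
    by_contra h
    refine hζ ?_
    have : ζ = Function.update η x (ζ x) := by
      funext y
      by_cases hy : y = x
      · subst hy; simp
      · rw [Function.update_of_ne hy]
        exact eq_of_resampleKernel_ne_zero (left_ne_zero_of_mul h) (by simpa using hy)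
    rw [this]
    cases ζ x <;> simp

lemma cvar_singleton (p : ℝ) (x : V) (f : (V → Bool) → ℝ) (η : V → Bool) :
    cvar p {x} f η = p * (1 - p) *
      (f (Function.update η x true) - f (Function.update η x false)) ^ 2 := by
  rw [cvar, cexp_singleton, cexp_singleton]
  ring

/-- A two-site path argument: flipping `x` under the constraint `a` is controlled by flipping
`x` under the constraint `a'` and flipping `y` under the constraint `s`, provided that, when `s`
holds, emptying `y` turns `a` into `a'`. -/
lemma mean_mul_cvar_le_of_path {p : ℝ} (h0 : 0 < p) (h1 : p < 1) {x y : V} (hxy : x ≠ y)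
    {a a' s : (V → Bool) → ℝ} (ha : ∀ η, a η = 0 ∨ a η = 1) (ha' : ∀ η, a' η = 0 ∨ a' η = 1)
    (hs : ∀ η, s η = 0 ∨ s η = 1) (hax : DependsOn a {x}ᶜ) (ha'x : DependsOn a' {x}ᶜ)
    (hsx : DependsOn s {x, y}ᶜ) (haa' : ∀ η, s η = 0 → a η ≤ a' η)
    (hpath : ∀ η, s η = 1 → a η ≤ a' (Function.update η y false)) (f : (V → Bool) → ℝ) :
    mean p (fun η => a η * cvar p {x} f η) ≤ 3 / (p * (1 - p)) *
      (mean p (fun η => a' η * cvar p {x} f η) + mean p (fun η => s η * cvar p {y} f η)) := by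
  have hq : 0 < 1 - p := by linarith
  rw [← mean_add, ← mean_const_mul, ← mean_cexp p {y}, ← mean_cexp p {x},
    ← mean_cexp p {y} (fun η => 3 / (p * (1 - p)) * _),
    ← mean_cexp p {x} (cexp p {y} fun η => 3 / (p * (1 - p)) * _)]
  refine mean_mono h0.le h1.le fun η => ?_
  set c : Bool → Bool → V → Bool := fun u v =>
    Function.update (Function.update η x u) y v with hc
  have hcx : ∀ u v b, Function.update (c u v) x b = c b v := fun u v b => by
    simp only [hc]
    rw [Function.update_comm hxy.symm, Function.update_idem]
  have hcy : ∀ u v b, Function.update (c u v) y b = c u b := fun u v b => by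
    simp only [hc, Function.update_idem]
  have hoffx : ∀ u u' v, ∀ z ∈ ({x}ᶜ : Set V), c u v z = c u' v z := fun u u' v z hz => by
    rw [← hcx u v u', Function.update_of_ne (by simpa using hz)]
  have hoff : ∀ u v, ∀ z ∈ ({x, y}ᶜ : Set V), c u v z = η z := fun u v z hz => by
    simp only [Set.mem_compl_iff, Set.mem_insert_iff, Set.mem_singleton_iff, not_or] at hz
    simp only [hc, Function.update_of_ne hz.2, Function.update_of_ne hz.1]
  have hA : ∀ u v, a (c u v) = a (c true v) := fun u v => hax (hoffx u true v)
  have hA' : ∀ u v, a' (c u v) = a' (c true v) := fun u v => ha'x (hoffx u true v)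
  have hS : ∀ u v, s (c u v) = s η := fun u v => hsx (hoff u v)
  have hdouble : ∀ F : (V → Bool) → ℝ, cexp p {x} (cexp p {y} F) η =
      p * (p * F (c true true) + (1 - p) * F (c true false)) +
        (1 - p) * (p * F (c false true) + (1 - p) * F (c false false)) := fun F => by
    simp only [cexp_singleton, hc]
  have hvx : ∀ u v, cvar p {x} f (c u v) = p * (1 - p) * (f (c true v) - f (c false v)) ^ 2 :=
    fun u v => by rw [cvar_singleton, hcx, hcx]
  have hvy : ∀ u v, cvar p {y} f (c u v) = p * (1 - p) * (f (c u true) - f (c u false)) ^ 2 :=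
    fun u v => by rw [cvar_singleton, hcy, hcy]
  rw [hdouble, hdouble]
  simp only [Pi.add_apply, hvx, hvy, hS, hA false, hA' false]
  set F₁₁ := f (c true true)
  set F₁₀ := f (c true false)
  set F₀₁ := f (c false true)
  set F₀₀ := f (c false false)
  set D₁ := p * (1 - p) * (F₁₁ - F₀₁) ^ 2 with hD₁
  set D₀ := p * (1 - p) * (F₁₀ - F₀₀) ^ 2 with hD₀
  set E₁ := p * (1 - p) * (F₁₁ - F₁₀) ^ 2 with hE₁
  set E₀ := p * (1 - p) * (F₀₁ - F₀₀) ^ 2 with hE₀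
  have hpq : 0 < p * (1 - p) := mul_pos h0 hq
  have hD₁0 : 0 ≤ D₁ := by positivity
  have hD₀0 : 0 ≤ D₀ := by positivity
  have hE₁0 : 0 ≤ E₁ := by positivity
  have hE₀0 : 0 ≤ E₀ := by positivity
  have hK : 1 ≤ 3 / (p * (1 - p)) := by
    rw [le_div_iff₀ hpq]
    nlinarith
  have hnn : ∀ {h : (V → Bool) → ℝ}, (∀ η, h η = 0 ∨ h η = 1) → ∀ η, 0 ≤ h η := fun hh η => by
    rcases hh η with h | h <;> simp [h]
  have ha'₁ := hnn ha' (c true true)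
  have ha'₀ := hnn ha' (c true false)
  rcases hs η with hs0 | hs1
  · have h₁ := mul_le_mul_of_nonneg_right (haa' (c true true) (by rw [hS, hs0])) hD₁0
    have h₀ := mul_le_mul_of_nonneg_right (haa' (c true false) (by rw [hS, hs0])) hD₀0
    have g₁ : a' (c true true) * D₁ ≤ 3 / (p * (1 - p)) * (a' (c true true) * D₁) :=
      le_mul_of_one_le_left (by positivity) hK
    have g₀ : a' (c true false) * D₀ ≤ 3 / (p * (1 - p)) * (a' (c true false) * D₀) :=
      le_mul_of_one_le_left (by positivity) hK
    have h₁' := mul_le_mul_of_nonneg_left (h₁.trans g₁) h0.le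
    have h₀' := mul_le_mul_of_nonneg_left (h₀.trans g₀) hq.le
    rw [hs0]
    linarith
  · have h₁ := hpath (c true true) (by rw [hS, hs1])
    have h₀ := hpath (c true false) (by rw [hS, hs1])
    rw [hcy] at h₁ h₀
    have ha₁ := hnn ha (c true true)
    have ha₀ := hnn ha (c true false)
    rw [hs1]
    rcases ha' (c true false) with h | h
    · rw [h] at h₁ h₀
      rw [le_antisymm h₁ ha₁, le_antisymm h₀ ha₀, h]
      simp only [zero_mul, mul_zero, add_zero, zero_add, one_mul]
      positivity
    · rw [h] at h₁ h₀
      have hD : D₁ ≤ 3 * (D₀ + E₁ + E₀) := by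
        have : (F₁₁ - F₀₁) ^ 2 ≤
            3 * ((F₁₀ - F₀₀) ^ 2 + (F₁₁ - F₁₀) ^ 2 + (F₀₁ - F₀₀) ^ 2) := by
          nlinarith [sq_nonneg ((F₁₀ - F₀₀) - (F₁₁ - F₁₀)), sq_nonneg ((F₁₀ - F₀₀) + (F₀₁ - F₀₀)),
            sq_nonneg ((F₁₁ - F₁₀) + (F₀₁ - F₀₀))]
        have := mul_le_mul_of_nonneg_left this hpq.le
        rw [hD₁, hD₀, hE₁, hE₀]
        linarith
      have k₁ : a (c true true) * D₁ ≤ D₁ := mul_le_of_le_one_left hD₁0 h₁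
      have k₀ : a (c true false) * D₀ ≤ D₀ := mul_le_of_le_one_left hD₀0 h₀
      have hKp : 3 / (p * (1 - p)) * p = 3 / (1 - p) := by field_simp
      have hKq : 3 / (p * (1 - p)) * (1 - p) = 3 / p := by field_simp
      have hq3 : 3 ≤ 3 / (1 - p) := by
        rw [le_div_iff₀ hq]; linarith
      have hp3 : 3 ≤ 3 / p := by
        rw [le_div_iff₀ h0]; linarith
      have hlhs : p * (a (c true true) * D₁) + (1 - p) * (a (c true false) * D₀) ≤
          3 * D₀ + 3 * E₁ + 3 * E₀ := by
        have e₁ := mul_le_mul_of_nonneg_left (k₁.trans hD) h0.le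
        have e₀ := mul_le_mul_of_nonneg_left k₀ hq.le
        nlinarith [mul_nonneg hq.le hD₀0, mul_nonneg hq.le hE₁0, mul_nonneg hq.le hE₀0]
      have r₁ := mul_le_mul_of_nonneg_right hq3 hE₁0
      have r₀ := mul_le_mul_of_nonneg_right hp3 hE₀0
      have r := mul_le_mul_of_nonneg_right hp3 hD₀0
      have rr : 0 ≤ 3 / (p * (1 - p)) * (p * (a' (c true true) * D₁)) := by positivity
      rw [h]
      calc _ = p * (a (c true true) * D₁) + (1 - p) * (a (c true false) * D₀) := by ring
        _ ≤ 3 * D₀ + 3 * E₁ + 3 * E₀ := hlhs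
        _ ≤ 3 / p * D₀ + 3 / (1 - p) * E₁ + 3 / p * E₀ +
            3 / (p * (1 - p)) * (p * (a' (c true true) * D₁)) := by linarith
        _ = _ := by
          rw [← hKp, ← hKq]
          ring

end SingleSite

section Forest

/-- A finite rooted forest of depth at most `L` in which every vertex at depth different from `L`
has exactly `k` children. -/
structure RegularForest (V : Type*) (k L : ℕ) where
  /-- the set of children -/
  ch : V → Finset V
  /-- the parent map (arbitrary at the roots) -/
  par : V → V
  /-- the depth -/
  dep : V → ℕ
  par_eq : ∀ x, ∀ y ∈ ch x, par y = x
  dep_eq : ∀ x, ∀ y ∈ ch x, dep y = dep x + 1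
  card_ch : ∀ x, dep x ≠ L → (ch x).card = k

namespace RegularForest

variable {V : Type*} {k L : ℕ} (F : RegularForest V k L)

/-- `F.Facilitated j n x η`: the bootstrap process using only the first `n` generations below `x`
makes at least `j` children of `x` empty, or `x` is an (unconstrained) leaf and `n ≠ 0`. -/
def Facilitated (j : ℕ) : ℕ → V → (V → Bool) → Prop
  | 0, _, _ => False
  | n + 1, x, η => F.dep x = L ∨
      j ≤ ((F.ch x).filter fun z => η z = false ∨ Facilitated j n z η).card

/-- Indicator of `Facilitated`. -/
def fac (j n : ℕ) (x : V) (η : V → Bool) : ℝ := if F.Facilitated j n x η then 1 else 0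

lemma fac_eq_zero_or_one (j n : ℕ) (x : V) (η : V → Bool) :
    F.fac j n x η = 0 ∨ F.fac j n x η = 1 := by
  unfold fac
  split_ifs <;> simp

variable [DecidableEq V]

/-- Strict descendants up to `n` generations. -/
def desc : ℕ → V → Finset V
  | 0, _ => ∅
  | n + 1, x => (F.ch x).biUnion fun z => insert z (desc n z)

lemma exists_iterate_par (n : ℕ) : ∀ x, ∀ y ∈ insert x (F.desc n x),
    ∃ i ≤ n, F.par^[i] y = x ∧ F.dep y = F.dep x + i := by
  induction n with
  | zero =>
    intro x y hy
    obtain rfl : y = x := by simpa [desc] using hy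
    exact ⟨0, le_rfl, rfl, rfl⟩
  | succ n ih =>
    intro x y hy
    rcases Finset.mem_insert.1 hy with rfl | hy
    · exact ⟨0, Nat.zero_le _, rfl, rfl⟩
    · obtain ⟨z, hz, hyz⟩ := Finset.mem_biUnion.1 hy
      obtain ⟨i, hi, h1, h2⟩ := ih z y hyz
      refine ⟨i + 1, by omega, ?_, ?_⟩
      · rw [Function.iterate_succ_apply', h1, F.par_eq x z hz]
      · rw [h2, F.dep_eq x z hz]
        omega

lemma dep_lt_of_mem_desc {n : ℕ} {x y : V} (hy : y ∈ F.desc n x) : F.dep x < F.dep y := by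
  cases n with
  | zero => simp [desc] at hy
  | succ n =>
    obtain ⟨z, hz, hyz⟩ := Finset.mem_biUnion.1 hy
    obtain ⟨i, -, -, h⟩ := F.exists_iterate_par n z y hyz
    rw [h, F.dep_eq x z hz]
    omega

lemma pairwiseDisjoint_desc (n : ℕ) (x : V) :
    (F.ch x : Set V).PairwiseDisjoint fun z => insert z (F.desc n z) := by
  intro z hz z' hz' hne
  refine Finset.disjoint_left.2 fun y hy hy' => hne ?_
  obtain ⟨i, -, h1, h2⟩ := F.exists_iterate_par n z y hy
  obtain ⟨i', -, h1', h2'⟩ := F.exists_iterate_par n z' y hy'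
  rw [F.dep_eq x z hz] at h2
  rw [F.dep_eq x z' hz'] at h2'
  obtain rfl : i = i' := by omega
  rw [← h1, ← h1']

lemma facilitated_congr (j n : ℕ) : ∀ (x : V) (η ζ : V → Bool),
    (∀ z ∈ F.desc n x, η z = ζ z) → (F.Facilitated j n x η ↔ F.Facilitated j n x ζ) := by
  induction n with
  | zero => intros; rfl
  | succ n ih =>
    intro x η ζ h
    have h' : ∀ z ∈ F.ch x, (η z = false ∨ F.Facilitated j n z η ↔
        ζ z = false ∨ F.Facilitated j n z ζ) := fun z hz => by
      rw [h z (Finset.mem_biUnion.2 ⟨z, hz, Finset.mem_insert_self _ _⟩), ih z η ζ fun w hw =>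
        h w (Finset.mem_biUnion.2 ⟨z, hz, Finset.mem_insert_of_mem hw⟩)]
    simp only [Facilitated]
    rw [Finset.filter_congr h']

lemma dependsOn_fac (j n : ℕ) (x : V) : DependsOn (F.fac j n x) ↑(F.desc n x) :=
  fun η ζ h => by simp only [fac, F.facilitated_congr j n x η ζ h]

lemma sum_powerset_indicator {ι : Type*} [DecidableEq ι] (S : Finset ι) (φ : Finset ι → ℝ)
    (X : ι → ℝ) (hX : ∀ i, X i = 0 ∨ X i = 1) :
    ∑ A ∈ S.powerset, φ A * ∏ i ∈ S, (if i ∈ A then X i else 1 - X i) =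
      φ (S.filter fun i => X i = 1) := by
  rw [Finset.sum_eq_single (S.filter fun i => X i = 1)]
  · rw [Finset.prod_eq_one, mul_one]
    intro i hi
    rcases hX i with h | h <;> simp [h, hi]
  · intro A hA hne
    rw [Finset.mem_powerset] at hA
    obtain ⟨i, hi⟩ : ∃ i ∈ S, ¬ (i ∈ A ↔ X i = 1) := by
      by_contra! hcon
      refine hne (Finset.ext fun i => ?_)
      rw [Finset.mem_filter]
      exact ⟨fun h => ⟨hA h, (hcon i (hA h)).1 h⟩, fun h => (hcon i h.1).2 h.2⟩
    rw [Finset.prod_eq_zero hi.1, mul_zero]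
    have := hi.2
    rcases hX i with h | h <;> by_cases h' : i ∈ A <;> simp_all
  · intro h
    exact absurd (Finset.mem_powerset.2 (Finset.filter_subset _ _)) h

lemma sum_powerset_binomial {ι : Type*} [DecidableEq ι] (S : Finset ι) (hS : S.card = k) (j : ℕ)
    (b : ℝ) :
    ∑ A ∈ S.powerset, (if k - j + 1 ≤ A.card then (1 : ℝ) else 0) *
      ∏ i ∈ S, (if i ∈ A then b else 1 - b) = g k j 1 b := by
  set φ : ℕ → ℝ := fun m =>
    (if k - j + 1 ≤ m then (1 : ℝ) else 0) * (b ^ m * (1 - b) ^ (k - m)) with hφ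
  have h : ∀ A ∈ S.powerset, (if k - j + 1 ≤ A.card then (1 : ℝ) else 0) *
      ∏ i ∈ S, (if i ∈ A then b else 1 - b) = φ A.card := by
    intro A hA
    rw [Finset.mem_powerset] at hA
    simp only [hφ]
    rw [Finset.prod_ite, Finset.prod_const, Finset.prod_const, Finset.filter_mem_eq_inter,
      Finset.inter_eq_right.2 hA, Finset.filter_notMem_eq_sdiff, Finset.card_sdiff_of_subset hA,
      hS]
  have hsub : Finset.Icc (k - j + 1) k ⊆ Finset.range (k + 1) := fun i hi =>
    Finset.mem_range.2 (Nat.lt_succ_of_le (Finset.mem_Icc.1 hi).2)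
  rw [Finset.sum_congr rfl h, Finset.sum_powerset_apply_card φ, hS, g, one_mul,
    ← Finset.sum_subset hsub]
  · refine Finset.sum_congr rfl fun i hi => ?_
    simp only [hφ]
    rw [if_pos (Finset.mem_Icc.1 hi).1, nsmul_eq_mul]
    ring
  · intro i hi hi'
    have : ¬ k - j + 1 ≤ i := fun h =>
      hi' (Finset.mem_Icc.2 ⟨h, Nat.le_of_lt_succ (Finset.mem_range.1 hi)⟩)
    simp only [hφ, if_neg this, zero_mul, smul_zero]

/-- Indicator that `x` is an unconstrained leaf, or at least `j` of its children are empty or else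
belong to `A` and are facilitated within `n` generations. -/
def partialFac (j n : ℕ) (A : Finset V) (x : V) (η : V → Bool) : ℝ :=
  if F.dep x = L ∨
    j ≤ ((F.ch x).filter fun z => η z = false ∨ (z ∈ A ∧ F.Facilitated j n z η)).card then 1 else 0

lemma partialFac_le {j n : ℕ} {A B : Finset V} {x : V} {η ζ : V → Bool}
    (h : ∀ z ∈ F.ch x, (η z = false ∨ (z ∈ A ∧ F.Facilitated j n z η)) →
      (ζ z = false ∨ (z ∈ B ∧ F.Facilitated j n z ζ))) :
    F.partialFac j n A x η ≤ F.partialFac j n B x ζ := by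
  have hcard := Finset.card_le_card fun z hz => Finset.mem_filter.2
    ⟨(Finset.mem_filter.1 hz).1, h z (Finset.mem_filter.1 hz).1 (Finset.mem_filter.1 hz).2⟩
  unfold partialFac
  split_ifs with h1 h2 h2
  · exact le_rfl
  · exact absurd (h1.imp id fun h => h.trans hcard) h2
  · exact zero_le_one
  · exact le_rfl

lemma dependsOn_partialFac (j n : ℕ) (A : Finset V) (x : V) :
    DependsOn (F.partialFac j n A x) ↑(F.desc (n + 1) x) := by
  have key : ∀ η ζ : V → Bool, (∀ w ∈ F.desc (n + 1) x, η w = ζ w) →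
      F.partialFac j n A x η ≤ F.partialFac j n A x ζ := fun η ζ h =>
    F.partialFac_le fun z hz => by
      rw [h z (Finset.mem_biUnion.2 ⟨z, hz, Finset.mem_insert_self _ _⟩),
        F.facilitated_congr j n z η ζ fun w hw =>
          h w (Finset.mem_biUnion.2 ⟨z, hz, Finset.mem_insert_of_mem hw⟩)]
      exact id
  exact fun η ζ h => le_antisymm (key η ζ h) (key ζ η fun w hw => (h w hw).symm)

lemma notMem_desc_of_dep_le {n : ℕ} {x y : V} (h : F.dep y ≤ F.dep x) : y ∉ F.desc n x :=
  fun hy => (F.dep_lt_of_mem_desc hy).not_ge h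

variable [Fintype V]

lemma card_filter_mem_desc_le (n : ℕ) (y : V) :
    (Finset.univ.filter fun x => y ∈ insert x (F.desc n x)).card ≤ n + 1 := by
  calc _ ≤ ((Finset.range (n + 1)).image fun i => F.par^[i] y).card := by
        refine Finset.card_le_card fun x hx => ?_
        obtain ⟨i, hi, h, -⟩ := F.exists_iterate_par n x y (Finset.mem_filter.1 hx).2
        exact Finset.mem_image.2 ⟨i, Finset.mem_range.2 (by omega), h⟩
    _ ≤ n + 1 := Finset.card_image_le.trans (by simp)

/-- The probability that a vertex is not facilitated within `n` generations only depends on its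
depth and decays exponentially in `n`. -/
lemma exists_mean_one_sub_fac {j : ℕ} (hjk : j ≤ k) {p ρ : ℝ} (h0 : 0 < p)
    (h1 : p ≤ 1) (hρ0 : 0 ≤ ρ) (hρ1 : ρ ≤ 1)
    (hg : ∀ x ∈ Set.Icc (0 : ℝ) 1, g k j p x ≤ ρ * x) (n : ℕ) :
    ∀ d : ℕ, ∃ b : ℝ, 0 ≤ b ∧ b ≤ ρ ^ n ∧
      ∀ x, F.dep x = d → mean p (fun η => 1 - F.fac j n x η) = b := by
  induction n with
  | zero =>
    intro d
    exact ⟨1, zero_le_one, by simp, fun x _ => by simp [fac, Facilitated, mean_const]⟩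
  | succ n ih =>
    intro d
    by_cases hd : d = L
    · refine ⟨0, le_rfl, pow_nonneg hρ0 _, fun x hx => ?_⟩
      have : F.dep x = L := hx.trans hd
      simp [fac, Facilitated, this, mean_const]
    · obtain ⟨b, hb0, hbρ, hb⟩ := ih (d + 1)
      have hb1 : b ≤ 1 := hbρ.trans (pow_le_one₀ hρ0 hρ1)
      have hpb0 : 0 ≤ p * b := by positivity
      have hpb1 : p * b ≤ 1 := mul_le_one₀ h1 hb0 hb1
      refine ⟨g k j 1 (p * b), g_nonneg k j zero_le_one hpb0 hpb1, ?_, fun x hx => ?_⟩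
      · have := hg (p * b) ⟨hpb0, hpb1⟩
        rw [g_eq_mul_g_one] at this
        have h2 : g k j 1 (p * b) ≤ ρ * b := by
          refine le_of_mul_le_mul_left ?_ h0
          linarith
        rw [pow_succ']
        exact h2.trans (mul_le_mul_of_nonneg_left hbρ hρ0)
      · have hxL : F.dep x ≠ L := fun h => hd (hx.symm.trans h)
        set X : V → (V → Bool) → ℝ := fun z η =>
          (if η z then 1 else 0) * (1 - F.fac j n z η) with hX
        have hX01 : ∀ z η, X z η = 0 ∨ X z η = 1 := fun z η => by
          rcases F.fac_eq_zero_or_one j n z η with h | h <;> cases h' : η z <;> simp [hX, h, h']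
        have hXdep : ∀ z, DependsOn (X z) ↑(insert z (F.desc n z)) := fun z η ζ h => by
          have e1 : η z = ζ z := h z (by simp)
          have e2 : F.fac j n z η = F.fac j n z ζ := F.dependsOn_fac j n z fun w hw =>
            h w (Finset.mem_coe.2 (Finset.mem_insert_of_mem hw))
          simp only [hX, e1, e2]
        have hXmean : ∀ z ∈ F.ch x, mean p (X z) = p * b := fun z hz => by
          have hz1 : DependsOn (fun η : V → Bool => if η z then (1 : ℝ) else 0)
              ↑({z} : Finset V) := fun η ζ h => by
            simp only [h z (by simp)]
          have hz2 : DependsOn (fun η => 1 - F.fac j n z η) ↑(F.desc n z) := fun η ζ h => by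
            simp only [F.dependsOn_fac j n z h]
          have hzz : z ∉ F.desc n z := fun h => lt_irrefl _ (F.dep_lt_of_mem_desc h)
          rw [hX, mean_mul_of_disjoint p hz1 hz2 (Finset.disjoint_singleton_left.2 hzz),
            hb z (by rw [F.dep_eq x z hz, hx])]
          congr 1
          rw [← mean_cexp p {z}]
          simp [funext (cexp_singleton p z _), mean_const]
        have hfac : (fun η => 1 - F.fac j (n + 1) x η) = fun η =>
            ∑ A ∈ (F.ch x).powerset, (if k - j + 1 ≤ A.card then (1 : ℝ) else 0) *
              ∏ z ∈ F.ch x, (if z ∈ A then X z η else 1 - X z η) := by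
          funext η
          rw [sum_powerset_indicator (F.ch x) (fun A => if k - j + 1 ≤ A.card then (1 : ℝ) else 0)
            (fun z => X z η) fun z => hX01 z η]
          have hcompl : ((F.ch x).filter fun z => ¬ (η z = false ∨ F.Facilitated j n z η)) =
              (F.ch x).filter fun z => X z η = 1 := by
            refine Finset.filter_congr fun z _ => ?_
            by_cases h : F.Facilitated j n z η <;> cases h' : η z <;> simp [hX, fac, h, h']
          have hcard := Finset.card_filter_add_card_filter_not (s := F.ch x)
            (fun z => η z = false ∨ F.Facilitated j n z η)
          rw [hcompl, F.card_ch x hxL] at hcard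
          have hiff : F.Facilitated j (n + 1) x η ↔
              ¬ k - j + 1 ≤ ((F.ch x).filter fun z => X z η = 1).card := by
            simp only [Facilitated, hxL, false_or]
            omega
          by_cases h : F.Facilitated j (n + 1) x η
          · simp [fac, h, hiff.1 h]
          · simp [fac, h, not_not.1 (mt hiff.2 h)]
        have hsum : ∀ (T : Finset (Finset V)) (G : Finset V → (V → Bool) → ℝ),
            mean p (fun η => ∑ A ∈ T, G A η) = ∑ A ∈ T, mean p (G A) := fun T G => by
          simp only [mean, Finset.mul_sum]
          exact Finset.sum_comm
        rw [hfac, hsum, ← sum_powerset_binomial (F.ch x) (F.card_ch x hxL) j]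
        refine Finset.sum_congr rfl fun A _ => ?_
        rw [mean_const_mul]
        congr 1
        rw [mean_prod_of_pairwiseDisjoint p (F.ch x)
          (fun z η => if z ∈ A then X z η else 1 - X z η) (fun z => insert z (F.desc n z))
          (fun z _ η ζ h => by simp only [hXdep z h]) (F.pairwiseDisjoint_desc n x)]
        refine Finset.prod_congr rfl fun z hz => ?_
        by_cases hzA : z ∈ A
        · simp only [hzA, if_true]
          exact hXmean z hz
        · simp only [hzA, if_false]
          have := mean_sub p (fun _ => 1) (X z)
          rw [mean_const, hXmean z hz] at this
          exact this

/-- One-generation reduction of the range of the constraint. -/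
lemma mean_fac_succ_mul_cvar_le {p : ℝ} (h0 : 0 < p) (h1 : p < 1) (j n : ℕ) (x : V)
    (f : (V → Bool) → ℝ) :
    mean p (fun η => F.fac j (n + 1) x η * cvar p {x} f η) ≤
      (3 / (p * (1 - p))) ^ (F.ch x).card *
        (mean p (fun η => F.fac j 1 x η * cvar p {x} f η) +
          ∑ z ∈ F.ch x, mean p (fun η => F.fac j n z η * cvar p {z} f η)) := by
  set K := 3 / (p * (1 - p)) with hK
  have hK1 : 1 ≤ K := by
    rw [hK, le_div_iff₀ (mul_pos h0 (by linarith))]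
    nlinarith
  have hdir : ∀ z, 0 ≤ mean p (fun η => F.fac j n z η * cvar p {z} f η) := fun z =>
    mean_nonneg h0.le h1.le fun η => mul_nonneg
      (by rcases F.fac_eq_zero_or_one j n z η with h | h <;> simp [h])
      (cvar_nonneg h0.le h1.le _ _ _)
  have h01 : ∀ A η, F.partialFac j n A x η = 0 ∨ F.partialFac j n A x η = 1 := fun A η => by
    unfold partialFac
    split_ifs <;> simp
  have hdepx : ∀ A, DependsOn (F.partialFac j n A x) {x}ᶜ := fun A =>
    (F.dependsOn_partialFac j n A x).mono fun y hy => by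
      rintro rfl
      exact F.notMem_desc_of_dep_le le_rfl hy
  have main : ∀ A ⊆ F.ch x, mean p (fun η => F.partialFac j n A x η * cvar p {x} f η) ≤
      K ^ A.card * (mean p (fun η => F.partialFac j n ∅ x η * cvar p {x} f η) +
        ∑ z ∈ A, mean p (fun η => F.fac j n z η * cvar p {z} f η)) := by
    intro A
    induction A using Finset.induction_on with
    | empty => simp
    | insert y A hyA ih =>
      intro hA
      have hy := hA (Finset.mem_insert_self _ _)
      have hdy := F.dep_eq x y hy
      have hpath := mean_mul_cvar_le_of_path h0 h1 (x := x) (y := y)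
        (by rintro rfl; omega) (h01 (insert y A)) (h01 A) (F.fac_eq_zero_or_one j n y)
        (hdepx _) (hdepx _)
        ((F.dependsOn_fac j n y).mono fun w hw => by
          simp only [Set.mem_compl_iff, Set.mem_insert_iff, Set.mem_singleton_iff]
          rintro (rfl | rfl)
          · exact F.notMem_desc_of_dep_le (by omega) hw
          · exact F.notMem_desc_of_dep_le le_rfl hw)
        (fun η hη => F.partialFac_le fun z _ hz => by
          refine hz.imp id fun h => ⟨?_, h.2⟩
          rcases Finset.mem_insert.1 h.1 with rfl | h'
          · simp [fac, h.2] at hη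
          · exact h')
        (fun η _ => F.partialFac_le fun z hzx hz => by
          by_cases hzy : z = y
          · subst hzy
            simp
          · rw [Function.update_of_ne hzy, F.facilitated_congr j n z _ η fun w hw =>
              Function.update_of_ne (by
                rintro rfl
                refine F.notMem_desc_of_dep_le ?_ hw
                rw [hdy, F.dep_eq x z hzx]) _ _]
            exact hz.imp id fun h => ⟨Finset.mem_of_mem_insert_of_ne h.1 hzy, h.2⟩) f
      have ih' := ih ((Finset.subset_insert _ _).trans hA)
      rw [Finset.card_insert_of_notMem hyA, Finset.sum_insert hyA, pow_succ']
      have hKA : 1 ≤ K ^ A.card := one_le_pow₀ hK1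
      have hy' := le_mul_of_one_le_left (hdir y) hKA
      have := mul_le_mul_of_nonneg_left (add_le_add ih' hy') (by linarith : 0 ≤ K)
      refine hpath.trans (this.trans (le_of_eq ?_))
      ring
  have := main (F.ch x) subset_rfl
  have e1 : F.partialFac j n (F.ch x) x = F.fac j (n + 1) x := by
    funext η
    have : ((F.ch x).filter fun z => η z = false ∨ (z ∈ F.ch x ∧ F.Facilitated j n z η)) =
        (F.ch x).filter fun z => η z = false ∨ F.Facilitated j n z η :=
      Finset.filter_congr fun z hz => by simp [hz]
    simp only [partialFac, fac, Facilitated, this]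
    congr
  have e2 : F.partialFac j n ∅ x = F.fac j 1 x := by
    funext η
    simp [partialFac, fac, Facilitated]
  rwa [e1, e2] at this

/-- The long-range Dirichlet form is controlled by the short-range one, uniformly in the forest. -/
lemma exists_sum_mean_fac_le (k : ℕ) {p : ℝ} (h0 : 0 < p) (h1 : p < 1) (j n : ℕ) :
    ∃ C : ℝ, 0 ≤ C ∧ ∀ (L : ℕ) (V : Type) [Fintype V] [DecidableEq V] (F : RegularForest V k L)
      (_ : ∀ x, F.dep x = L → F.ch x = ∅) (f : (V → Bool) → ℝ),
      ∑ x, mean p (fun η => F.fac j n x η * cvar p {x} f η) ≤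
        C * ∑ x, mean p (fun η => F.fac j 1 x η * cvar p {x} f η) := by
  induction n with
  | zero => exact ⟨0, le_rfl, fun L V _ _ F _ f => by simp [fac, Facilitated, mean_const]⟩
  | succ n ih =>
    obtain ⟨C, hC, ih⟩ := ih
    set K := 3 / (p * (1 - p)) with hK
    have hK1 : 1 ≤ K := by
      rw [hK, le_div_iff₀ (mul_pos h0 (by linarith))]
      nlinarith
    refine ⟨K ^ k * (1 + C), by positivity, fun L V _ _ F hleaf f => ?_⟩
    have hnn : ∀ m z, 0 ≤ mean p (fun η => F.fac j m z η * cvar p {z} f η) := fun m z =>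
      mean_nonneg h0.le h1.le fun η => mul_nonneg
        (by rcases F.fac_eq_zero_or_one j m z η with h | h <;> simp [h])
        (cvar_nonneg h0.le h1.le _ _ _)
    have hcard : ∀ x, (F.ch x).card ≤ k := fun x => by
      by_cases hx : F.dep x = L
      · simp [hleaf x hx]
      · exact (F.card_ch x hx).le
    have hchildren : ∑ x, ∑ z ∈ F.ch x, mean p (fun η => F.fac j n z η * cvar p {z} f η) ≤
        ∑ z, mean p (fun η => F.fac j n z η * cvar p {z} f η) := by
      rw [← Finset.sum_biUnion]
      · exact Finset.sum_le_univ_sum_of_nonneg fun z => hnn n z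
      · intro x _ y _ hxy
        exact Finset.disjoint_left.2 fun z hz hz' =>
          hxy ((F.par_eq x z hz).symm.trans (F.par_eq y z hz'))
    calc _ ≤ ∑ x, K ^ k * (mean p (fun η => F.fac j 1 x η * cvar p {x} f η) +
          ∑ z ∈ F.ch x, mean p (fun η => F.fac j n z η * cvar p {z} f η)) := by
          refine Finset.sum_le_sum fun x _ => (F.mean_fac_succ_mul_cvar_le h0 h1 j n x f).trans ?_
          exact mul_le_mul_of_nonneg_right (pow_le_pow_right₀ hK1 (hcard x))
            (add_nonneg (hnn 1 x) (Finset.sum_nonneg fun z _ => hnn n z))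
      _ ≤ _ := by
          rw [← Finset.mul_sum, Finset.sum_add_distrib, mul_assoc, add_mul, one_mul]
          refine mul_le_mul_of_nonneg_left ?_ (by positivity)
          linarith [ih L V F hleaf f]

end RegularForest

lemma exists_injective_lt_of_lt {V : Type*} [Fintype V] (d : V → ℕ) :
    ∃ e : V → ℕ, Function.Injective e ∧ ∀ x y, d x < d y → e x < e y := by
  set E := Fintype.equivFin V
  have hlt : ∀ x y, d x < d y → d x * Fintype.card V + E x < d y * Fintype.card V + E y := by
    intro x y h
    have h1 : (d x + 1) * Fintype.card V ≤ d y * Fintype.card V := Nat.mul_le_mul_right _ h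
    have h2 := (E x).isLt
    rw [add_mul, one_mul] at h1
    omega
  refine ⟨fun x => d x * Fintype.card V + E x, fun x y h => ?_, hlt⟩
  rcases lt_trichotomy (d x) (d y) with h' | h' | h'
  · exact absurd h (hlt x y h').ne
  · simp only [h', add_right_inj] at h
    exact E.injective (Fin.ext h)
  · exact absurd h (hlt y x h').ne'

end Forest

section Ball

variable {k L : ℕ}

lemma bdepth_le (x : BV k L) : bdepth x ≤ L := by
  rcases x with _ | ⟨m, a, w⟩
  · exact Nat.zero_le _
  · exact m.isLt

lemma bdepth_of_oneStep {x y : BV k L} (h : oneStep x y) : bdepth y = bdepth x + 1 := by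
  rcases x with _ | ⟨m, a, w⟩ <;> rcases y with _ | ⟨m', b, w'⟩
  · exact h.elim
  · have h' : m'.val = 0 := h
    simp [bdepth, h']
  · exact h.elim
  · obtain ⟨-, h', -⟩ := h
    simp [bdepth, h']

lemma oneStep_left_unique {x x' y : BV k L} (h : oneStep x y) (h' : oneStep x' y) : x = x' := by
  have hd : bdepth x = bdepth x' := by
    have := bdepth_of_oneStep h
    have := bdepth_of_oneStep h'
    omega
  rcases x with _ | ⟨m, a, w⟩ <;> rcases x' with _ | ⟨m', a', w'⟩
  · rfl
  · simp [bdepth] at hd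
  · simp [bdepth] at hd
  · rcases y with _ | ⟨n, b, v⟩
    · exact h.elim
    · obtain rfl : m = m' := Fin.ext (by simpa [bdepth] using hd)
      obtain ⟨rfl, h1, h2⟩ := h
      obtain ⟨rfl, h1', h2'⟩ := h'
      obtain rfl : w = w' := funext fun i => (h2 i).symm.trans (h2' i)
      rfl

/-- The `i`-th child of `x`; for the root, only `k` of the `k + 1` children are listed. -/
def childMap : (x : BV k L) → bdepth x < L → Fin k → BV k L
  | none, h, i => some ⟨⟨0, h⟩, i.castSucc, Fin.elim0⟩
  | some ⟨m, a, w⟩, h, i => some ⟨⟨m.val + 1, h⟩, a, Fin.snoc (α := fun _ => Fin k) w i⟩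

lemma oneStep_childMap (x : BV k L) (h : bdepth x < L) (i : Fin k) :
    oneStep x (childMap x h i) := by
  rcases x with _ | ⟨m, a, w⟩
  · rfl
  · exact ⟨rfl, rfl, fun i => Fin.snoc_castSucc (α := fun _ => Fin k) _ _ _⟩

lemma childMap_injective (x : BV k L) (h : bdepth x < L) :
    Function.Injective (childMap x h) := by
  rcases x with _ | ⟨m, a, w⟩
  · intro i i' hii
    simpa [childMap] using hii
  · intro i i' hii
    simp only [childMap, Option.some.injEq, Sigma.mk.injEq, heq_eq_eq, Prod.mk.injEq, true_and]
      at hii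
    have := congrFun hii (Fin.last _)
    simpa [Fin.snoc_last] using this

/-- The ball as a regular forest: one of the subtrees of the root is detached. -/
def ballForest (k L : ℕ) : RegularForest (BV k L) k L where
  ch x := if h : bdepth x < L then Finset.univ.image (childMap x h) else ∅
  par y := if h : ∃ x, oneStep x y then h.choose else y
  dep := bdepth
  par_eq x y hy := by
    split_ifs at hy with h
    · obtain ⟨i, -, rfl⟩ := Finset.mem_image.1 hy
      have hex : ∃ x', oneStep x' (childMap x h i) := ⟨x, oneStep_childMap x h i⟩
      rw [dif_pos hex]
      exact oneStep_left_unique hex.choose_spec (oneStep_childMap x h i)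
    · simp at hy
  dep_eq x y hy := by
    split_ifs at hy with h
    · obtain ⟨i, -, rfl⟩ := Finset.mem_image.1 hy
      exact bdepth_of_oneStep (oneStep_childMap x h i)
    · simp at hy
  card_ch x hx := by
    rw [dif_pos (lt_of_le_of_ne (bdepth_le x) hx),
      Finset.card_image_of_injective _ (childMap_injective x _), Finset.card_univ,
      Fintype.card_fin]

lemma oneStep_of_mem_ballForest_ch {x y : BV k L} (hy : y ∈ (ballForest k L).ch x) :
    oneStep x y := by
  simp only [ballForest] at hy
  split_ifs at hy with h
  · obtain ⟨i, -, rfl⟩ := Finset.mem_image.1 hy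
    exact oneStep_childMap x h i
  · simp at hy

lemma ballForest_fac_one_le_cU (j : ℕ) (x : BV k L) (η : BV k L → Bool) :
    (ballForest k L).fac j 1 x η ≤ cU j x η := by
  have hcard : ((ballForest k L).ch x |>.filter fun z => η z = false).card ≤
      (Finset.univ.filter fun y : BV k L => adj x y ∧ η y = false).card := by
    refine Finset.card_le_card fun y hy => ?_
    rw [Finset.mem_filter] at hy
    exact Finset.mem_filter.2
      ⟨Finset.mem_univ _, Or.inl (oneStep_of_mem_ballForest_ch hy.1), hy.2⟩
  have hdep : (ballForest k L).dep x = bdepth x := rfl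
  simp only [RegularForest.fac, RegularForest.Facilitated, or_false, hdep, cU]
  split_ifs with h1 h2 h3 h2 h3
  all_goals first
    | exact le_rfl
    | exact zero_le_one
    | exact absurd ((h1.resolve_left h2).trans hcard) h3

end Ball

theorem unoriented_FA_poincare (k j : ℕ) (p : ℝ) (hk : 2 ≤ k) (hj : 2 ≤ j) (hjk : j ≤ k)
    (hp0 : 0 < p) (hp : p < ptilde k j) :
    ∃ lam : ℝ, 1 ≤ lam ∧ ∀ (L : ℕ) (f : (BV k L → Bool) → ℝ),
      varTot p f ≤ lam * ∑ x : BV k L, mean p (fun η => cU j x η * cvar p {x} f η) := by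
  have hj1 : 1 ≤ j := by omega
  obtain ⟨hp1, ρ, hρ0, hρ1, hg⟩ := exists_contraction_of_lt_ptilde hj1 hjk hp0 hp
  obtain ⟨n, hn⟩ : ∃ n : ℕ, 4 * (ρ ^ n * ((n + 1 : ℕ) : ℝ)) ≤ 1 := by
    have h1 : Filter.Tendsto (fun n : ℕ => (n : ℝ) * ρ ^ n) Filter.atTop (nhds 0) :=
      tendsto_self_mul_const_pow_of_lt_one hρ0 hρ1
    have h2 : Filter.Tendsto (fun n : ℕ => ρ ^ n) Filter.atTop (nhds 0) :=
      tendsto_pow_atTop_nhds_zero_of_lt_one hρ0 hρ1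
    have h3 := h1.add h2
    rw [add_zero] at h3
    obtain ⟨n, hn⟩ := (h3.eventually_le_const (by norm_num : (0 : ℝ) < 1 / 4)).exists
    refine ⟨n, ?_⟩
    push_cast
    linarith
  obtain ⟨C, hC, hCle⟩ := RegularForest.exists_sum_mean_fac_le k hp0 hp1 j n
  refine ⟨1 + 4 * C, by linarith, fun L f => ?_⟩
  set F := ballForest k L with hF
  obtain ⟨e, he, hlt⟩ := exists_injective_lt_of_lt F.dep
  have hlong := varTot_le_of_constraint hp0.le hp1.le he (F.desc n)
    (fun x y hy => hlt x y (F.dep_lt_of_mem_desc hy)) (F.fac j n) (F.fac_eq_zero_or_one j n)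
    (F.dependsOn_fac j n) (δ := ρ ^ n) (M := n + 1)
    (fun x => by
      obtain ⟨b, -, hb, hbx⟩ :=
        F.exists_mean_one_sub_fac hjk hp0 hp1.le hρ0 hρ1.le hg n (F.dep x)
      exact (hbx x rfl).trans_le hb)
    (F.card_filter_mem_desc_le n) hn f
  have hshort := hCle L (BV k L) F (fun x hx => by
    have : ¬ bdepth x < L := not_lt.2 (ge_of_eq hx)
    simp [hF, ballForest, this]) f
  have hU : ∑ x, mean p (fun η => F.fac j 1 x η * cvar p {x} f η) ≤
      ∑ x : BV k L, mean p (fun η => cU j x η * cvar p {x} f η) :=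
    Finset.sum_le_sum fun x _ => mean_mono hp0.le hp1.le fun η =>
      mul_le_mul_of_nonneg_right (ballForest_fac_one_le_cU j x η)
        (cvar_nonneg hp0.le hp1.le _ _ _)
  have hU0 : 0 ≤ ∑ x : BV k L, mean p (fun η => cU j x η * cvar p {x} f η) :=
    Finset.sum_nonneg fun x _ => mean_nonneg hp0.le hp1.le fun η =>
      mul_nonneg (by unfold cU; split_ifs <;> simp) (cvar_nonneg hp0.le hp1.le _ _ _)
  have := mul_le_mul_of_nonneg_left hU hC
  linarith
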